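/- The alliance polynomial of the empty graph E_n on n ≥ 1 vertices (no edges) is A(E_n;x) = n·x^n. Conversely, if a finite simple graph Γ satisfies A(Γ;x) = n·x^n, then Γ is isomorphic to E_n. -/

import Mathlib

open Finset Polynomial
open scoped Classical

noncomputable section

variable {V : Type*} [Fintype V]

/-- Number of neighbors of `v` inside `S` (as an integer). -/
def degIn (G : SimpleGraph V) (S : Finset V) (v : V) : ℤ :=
  ((S.filter (fun u => G.Adj v u)).card : ℤ)

/-- Number of neighbors of `v` outside `S` (as an integer). -/
def degOut (G : SimpleGraph V) (S : Finset V) (v : V) : ℤ :=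
  ((Sᶜ.filter (fun u => G.Adj v u)).card : ℤ)

/-- The exact index of alliance of `S`. -/
def exactIndex (G : SimpleGraph V) (S : Finset V) : ℤ :=
  if h : S.Nonempty then S.inf' h (fun v => degIn G S v - degOut G S v) else 0

/-- Nonempty vertex subsets inducing a connected subgraph. -/
def goodSets (G : SimpleGraph V) : Finset (Finset V) :=
  Finset.univ.filter (fun S => S.Nonempty ∧ (G.induce (S : Set V)).Connected)

/-- The alliance polynomial. -/
def alliancePoly (G : SimpleGraph V) : Polynomial ℤ :=
  ∑ S ∈ goodSets G, X ^ (((Fintype.card V : ℤ) + exactIndex G S).toNat)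

/-- `A_k(Γ)`: number of connected exact defensive `k`-alliances. -/
def allianceCount (G : SimpleGraph V) (k : ℤ) : ℕ :=
  ((goodSets G).filter (fun S => exactIndex G S = k)).card

end

theorem exactIndex_bot {V : Type*} [Fintype V] (S : Finset V) :
    exactIndex (⊥ : SimpleGraph V) S = 0 := by
  unfold exactIndex
  split_ifs with h
  · simp [degIn, degOut]
  · rfl

theorem exactIndex_singleton {V : Type*} [Fintype V] (G : SimpleGraph V) (v : V) :
    exactIndex G {v} = -(#{u | G.Adj v u} : ℤ) := by
  have h : (({v} : Finset V)ᶜ.filter fun u => G.Adj v u) =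
      Finset.univ.filter fun u => G.Adj v u := by
    ext u
    simpa using fun h => h.ne'
  rw [← h]
  simp [exactIndex, degIn, degOut, Finset.filter_singleton]

theorem singleton_mem_goodSets {V : Type*} [Fintype V] (G : SimpleGraph V) (v : V) :
    {v} ∈ goodSets G := by
  have : (G.induce (({v} : Finset V) : Set V)).Connected := by
    rw [Finset.coe_singleton]
    have : Nonempty ({v} : Set V) := ⟨⟨v, rfl⟩⟩
    exact ⟨.of_subsingleton⟩
  exact Finset.mem_filter.mpr ⟨Finset.mem_univ _, Finset.singleton_nonempty v, this⟩

theorem card_le_card_goodSets {V : Type*} [Fintype V] (G : SimpleGraph V) :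
    Fintype.card V ≤ #(goodSets G) :=
  Finset.card_le_card_of_injOn (s := Finset.univ) (fun v => {v})
    (fun v _ => singleton_mem_goodSets G v) (Finset.singleton_injective.injOn)

theorem goodSets_bot (V : Type*) [Fintype V] :
    goodSets (⊥ : SimpleGraph V) = (Finset.univ : Finset V).image fun v => ({v} : Finset V) := by
  ext S
  constructor
  · intro hS
    simp only [goodSets, Finset.mem_filter] at hS
    obtain ⟨-, ⟨v, hv⟩, hc⟩ := hS
    refine Finset.mem_image.mpr ⟨v, Finset.mem_univ v, ?_⟩
    refine (Finset.eq_singleton_iff_unique_mem.mpr ⟨hv, fun u hu => ?_⟩).symm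
    have hr := hc.preconnected ⟨u, hu⟩ ⟨v, hv⟩
    have hb : (⊥ : SimpleGraph V).induce (S : Set V) = ⊥ := by ext; simp
    rw [hb, SimpleGraph.reachable_bot] at hr
    exact congrArg Subtype.val hr
  · intro hS
    obtain ⟨v, -, rfl⟩ := Finset.mem_image.mp hS
    exact singleton_mem_goodSets ⊥ v

theorem alliancePoly_bot (V : Type*) [Fintype V] :
    alliancePoly (⊥ : SimpleGraph V) = (Fintype.card V : ℤ[X]) * X ^ Fintype.card V := by
  have hc : #(goodSets (⊥ : SimpleGraph V)) = Fintype.card V := by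
    rw [goodSets_bot, Finset.card_image_of_injective _ Finset.singleton_injective,
      Finset.card_univ]
  simp [alliancePoly, exactIndex_bot, hc]

/-- A sum of monic monomials which is a multiple of `X ^ n` has all its exponents equal to `n`. -/
theorem eq_of_sum_X_pow_eq {ι : Type*} {s : Finset ι} {e : ι → ℕ} {c n : ℕ}
    (h : ∑ i ∈ s, (X : ℤ[X]) ^ e i = (c : ℤ[X]) * X ^ n) {i : ι} (hi : i ∈ s) : e i = n := by
  by_contra hne
  have hk := congrArg (fun p => p.coeff (e i)) h
  simp only [Polynomial.finsetSum_coeff, Polynomial.coeff_X_pow, Polynomial.coeff_natCast_mul,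
    if_neg hne, mul_zero] at hk
  have hz := (Finset.sum_eq_zero_iff_of_nonneg fun j _ => by split_ifs <;> simp).mp hk i hi
  simp at hz

theorem card_eq_of_sum_X_pow_eq {ι : Type*} {s : Finset ι} {e : ι → ℕ} {c n : ℕ}
    (h : ∑ i ∈ s, (X : ℤ[X]) ^ e i = (c : ℤ[X]) * X ^ n) : #s = c := by
  have h1 := congrArg (Polynomial.eval 1) h
  simp only [Polynomial.eval_finsetSum, Polynomial.eval_pow, Polynomial.eval_X, one_pow,
    Polynomial.eval_mul, Polynomial.eval_natCast, Finset.sum_const, nsmul_eq_mul, mul_one] at h1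
  exact_mod_cast h1

/-- `A(E_n;x) = n·x^n`, and any graph with this alliance polynomial
is isomorphic to the empty graph `E_n`. -/
theorem alliancePoly_empty_graph (n : ℕ) (hn : 1 ≤ n) {V : Type*} [Fintype V]
    (G : SimpleGraph V) :
    alliancePoly (⊥ : SimpleGraph (Fin n)) = (n : Polynomial ℤ) * X ^ n ∧
    (alliancePoly G = (n : Polynomial ℤ) * X ^ n →
      Nonempty (G ≃g (⊥ : SimpleGraph (Fin n)))) := by
  refine ⟨by simpa using alliancePoly_bot (Fin n), fun h => ?_⟩
  have hle : Fintype.card V ≤ n :=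
    (card_le_card_goodSets G).trans_eq (card_eq_of_sum_X_pow_eq h)
  have hdeg (v : V) : ((Fintype.card V : ℤ) - #{u | G.Adj v u}).toNat = n := by
    simpa only [exactIndex_singleton, sub_eq_add_neg] using
      eq_of_sum_X_pow_eq h (singleton_mem_goodSets G v)
  have hne : Nonempty V := by
    have hpos : 0 < #(goodSets G) := by
      rw [card_eq_of_sum_X_pow_eq h]
      exact hn
    obtain ⟨S, hS⟩ := Finset.card_pos.mp hpos
    obtain ⟨v, -⟩ := (Finset.mem_filter.mp hS).2.1
    exact ⟨v⟩
  have hcard : Fintype.card V = n := by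
    have := hdeg hne.some
    omega
  have hG : G = ⊥ := by
    refine SimpleGraph.eq_bot_iff_forall_not_adj.mpr fun v w hvw => ?_
    have hpos : 0 < #{u | G.Adj v u} := Finset.card_pos.mpr ⟨w, by simpa using hvw⟩
    have := hdeg v
    omega
  subst hG
  exact ⟨⟨Fintype.equivFinOfCardEq hcard, by simp⟩⟩
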